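/- arXiv:2001.05686 — 2 statements merged into one kernel-verified Lean document; each statement's English description precedes it below -/
import Mathlib

section
/- For every non-negative integer n, the partition function satisfies p(5n + 4) ≡ 0 (mod 5). -/
open PowerSeries

/-- Power series over `ZMod 5`. -/
abbrev PS5 : Type := PowerSeries (ZMod 5)

/-- The finite product `(q)_M`. -/
noncomputable def qp (M : ℕ) : PS5 := ∏ i ∈ Finset.range M, (1 - (X : PS5) ^ (i + 1))

theorem qp_zero : qp 0 = 1 := by simp [qp]

theorem qp_succ (M : ℕ) : qp (M + 1) = qp M * (1 - (X : PS5) ^ (M + 1)) := by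
  simp [qp, Finset.prod_range_succ]

/-- The Euler function. -/
noncomputable def eul : PS5 := pentagonalSeries (ZMod 5)

theorem prod_tail_dvd (M : ℕ) (t : Finset ℕ) (ht : ∀ i ∈ t, M ≤ i) :
    (X : PS5) ^ (M + 1) ∣ (∏ i ∈ t, (1 - (X : PS5) ^ (i + 1))) - 1 := by
  induction t using Finset.induction_on with
  | empty => simp
  | insert a s ha ih =>
    rw [Finset.prod_insert ha]
    have h1 := ih fun i hi => ht i (Finset.mem_insert_of_mem hi)
    have h2 : (X : PS5) ^ (M + 1) ∣ X ^ (a + 1) :=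
      pow_dvd_pow _ (by have := ht a (Finset.mem_insert_self a s); omega)
    have h3 := dvd_sub h1 (h2.mul_right (∏ i ∈ s, (1 - (X : PS5) ^ (i + 1))))
    convert h3 using 1
    ring

theorem eul_sub_qp (M : ℕ) : (X : PS5) ^ (M + 1) ∣ eul - qp M := by
  rw [X_pow_dvd_iff]
  intro j hj
  obtain ⟨s, hs⟩ := Filter.eventually_atTop.mp
    (coeff_prod_one_sub_X_pow_eventually_eq (ZMod 5) j)
  have h := hs (s ∪ Finset.range M) (by simp)
  have hsplit := Finset.prod_sdiff (f := fun i => (1 - (X : PS5) ^ (i + 1)))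
    (Finset.subset_union_right (s₁ := s) (s₂ := Finset.range M))
  have ht := prod_tail_dvd M ((s ∪ Finset.range M) \ Finset.range M) (by
    intro i hi
    simp at hi
    omega)
  have h2 := X_pow_dvd_iff.mp (ht.mul_right (qp M)) j hj
  rw [sub_mul, one_mul] at h2
  unfold qp at h2 ⊢
  rw [hsplit, map_sub, h] at h2
  rw [map_sub]
  exact h2

theorem isUnit_of_cc {f : PS5} (h : constantCoeff f = 1) : IsUnit f := by
  rw [PowerSeries.isUnit_iff_constantCoeff, h]
  exact isUnit_one

theorem qp_unit (M : ℕ) : IsUnit (qp M) := by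
  apply isUnit_of_cc
  simp [qp]

theorem eul_unit : IsUnit eul := by
  apply isUnit_of_cc
  have := X_pow_dvd_iff.mp (eul_sub_qp 0) 0 (by omega)
  rw [qp_zero] at this
  simpa [sub_eq_zero] using this

/-- Coefficients of the finite triple product. -/
noncomputable def jc : ℕ → ℕ → PS5
  | 0, 0 => 1
  | 0, _ + 1 => 0
  | n + 1, 0 => (1 + X ^ (2 * n + 2) + X ^ (n + 1)) * jc n 0 - X ^ (n + 1) * jc n 1
  | n + 1, k + 1 => (1 + X ^ (2 * n + 2)) * jc n (k + 1)
      - X ^ (n + 1) * (jc n k + jc n (k + 2))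

theorem jc_zero_of_lt (n : ℕ) : ∀ k, n < k → jc n k = 0 := by
  induction n with
  | zero => intro k hk; obtain ⟨k, rfl⟩ := Nat.exists_eq_succ_of_ne_zero hk.ne'; simp [jc]
  | succ n ih =>
    intro k hk
    obtain ⟨k, rfl⟩ := Nat.exists_eq_succ_of_ne_zero (n := k) (by omega)
    simp only [jc]
    rw [ih (k + 1) (by omega), ih k (by omega), ih (k + 2) (by omega)]
    simp

theorem jc_shift_sum (c : ℕ → PS5) (N : ℕ) (h1 : c (N + 1) = 0) (h2 : c (N + 2) = 0)
    (h0 : c N = 0) (a b : PS5) :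
    ((a + b) * c 0 - b * c 1) + ∑ k ∈ Finset.range N, (2 * ((k : PS5) + 1) + 1) *
      (a * c (k + 1) - b * (c k + c (k + 2)))
    = (a - 2 * b) * ∑ k ∈ Finset.range N, (2 * (k : PS5) + 1) * c k := by
  have key : ∀ M : ℕ, ((a + b) * c 0 - b * c 1) + ∑ k ∈ Finset.range M, (2 * ((k : PS5) + 1) + 1) *
      (a * c (k + 1) - b * (c k + c (k + 2)))
    = (a - 2 * b) * ∑ k ∈ Finset.range M, (2 * (k : PS5) + 1) * c k
      + (2 * (M : PS5) + 1) * (a * c M - b * c (M + 1)) + (1 - 2 * (M : PS5)) * b * c M := by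
    intro M
    induction M with
    | zero => simp; ring
    | succ M ih =>
      rw [Finset.sum_range_succ, Finset.sum_range_succ, ← add_assoc, ih]
      push_cast
      ring
  rw [key N, h0, h1]
  ring

theorem jc_sum (n : ℕ) :
    ∀ N, n < N → ∑ k ∈ Finset.range N, (2 * (k : PS5) + 1) * jc n k = qp n ^ 2 := by
  induction n with
  | zero =>
    intro N hN
    obtain ⟨N, rfl⟩ := Nat.exists_eq_succ_of_ne_zero (n := N) (by omega)
    rw [Nat.succ_eq_add_one, Finset.sum_range_succ']
    simp [jc, qp_zero]
  | succ n ih =>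
    intro N hN
    obtain ⟨N, rfl⟩ := Nat.exists_eq_succ_of_ne_zero (n := N) (by omega)
    rw [Nat.succ_eq_add_one, Finset.sum_range_succ']
    have h := jc_shift_sum (jc n) N (jc_zero_of_lt _ _ (by omega)) (jc_zero_of_lt _ _ (by omega))
      (jc_zero_of_lt _ _ (by omega)) (1 + X ^ (2 * n + 2)) (X ^ (n + 1))
    rw [ih N (by omega)] at h
    simp only [jc]
    push_cast
    rw [qp_succ]
    linear_combination h

/-- Triangular numbers. -/
def tri : ℕ → ℕ
  | 0 => 0
  | k + 1 => tri k + (k + 1)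

theorem jc_closed (n : ℕ) : ∀ k m, n = k + m →
    jc n k * (qp m * qp (n + k + 1)) = (-1) ^ k * X ^ tri k * qp (2 * n + 1) := by
  induction n with
  | zero =>
    intro k m h
    obtain rfl : k = 0 := by omega
    obtain rfl : m = 0 := by omega
    simp [jc, tri, qp_zero]
  | succ n ih =>
    intro k m h
    have e1 : 2 * (n + 1) + 1 = 2 * n + 1 + 1 + 1 := by ring
    rw [e1]
    rcases k with _ | k
    · obtain rfl : m = n + 1 := by omega
      have i0 := ih 0 n (by omega)
      simp only [jc]
      rcases n with _ | n
      · rw [jc_zero_of_lt 0 1 (by omega)]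
        simp [jc, tri, qp_zero, qp_succ]
        ring
      · have i1 := ih 1 n (by omega)
        simp only [tri, pow_zero, one_mul, pow_one, zero_add, add_zero] at i0 i1 ⊢
        simp only [qp_succ] at i0 i1 ⊢
        linear_combination
          (1 + X ^ (2 * (n + 1) + 2) + X ^ (n + 1 + 1)) * (1 - X ^ (n + 2)) * (1 - X ^ (n + 3)) * i0
          - X ^ (n + 2) * (1 - X ^ (n + 1)) * (1 - X ^ (n + 2)) * i1
    · obtain rfl : n = k + m := by omega
      have i0 := ih k m (by omega)
      simp only [jc]
      have e2 : k + m + 1 + (k + 1) + 1 = k + m + k + 1 + 1 + 1 := by ring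
      rw [e2]
      rcases m with _ | _ | m
      · rw [jc_zero_of_lt (k + 0) (k + 1) (by omega), jc_zero_of_lt (k + 0) (k + 2) (by omega)]
        simp only [tri, add_zero, qp_zero] at i0 ⊢
        simp only [qp_succ] at i0 ⊢
        linear_combination
          - X ^ (k + 1) * (1 - X ^ (k + k + 2)) * (1 - X ^ (k + k + 3)) * i0
      · rw [jc_zero_of_lt (k + (0 + 1)) (k + 2) (by omega)]
        have i1 := ih (k + 1) 0 (by omega)
        have e3 : k + (0 + 1) + (k + 1) + 1 = k + (0 + 1) + k + 1 + 1 := by ring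
        rw [e3] at i1
        simp only [tri, qp_zero] at i0 i1 ⊢
        simp only [qp_succ, qp_zero] at i0 i1 ⊢
        linear_combination
          (1 + X ^ (2 * (k + 1) + 2)) * (1 - X) * (1 - X ^ (k + 1 + k + 3)) * i1
          - X ^ (k + 1 + 1) * (1 - X ^ (k + 1 + k + 2)) * (1 - X ^ (k + 1 + k + 3)) * i0
      · have i1 := ih (k + 1) (m + 1) (by omega)
        have i2 := ih (k + 2) m (by omega)
        have e3 : k + (m + 1 + 1) + (k + 1) + 1 = k + (m + 1 + 1) + k + 1 + 1 := by ring
        have e4 : k + (m + 1 + 1) + (k + 2) + 1 = k + (m + 1 + 1) + k + 1 + 1 + 1 := by ring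
        rw [e3] at i1
        rw [e4] at i2
        simp only [tri] at i0 i1 i2 ⊢
        simp only [qp_succ] at i0 i1 i2 ⊢
        linear_combination
          (1 + X ^ (2 * (k + m + 2) + 2)) * (1 - X ^ (m + 2)) * (1 - X ^ (k + m + 2 + k + 3)) * i1
          - X ^ (k + m + 2 + 1) * (1 - X ^ (k + m + 2 + k + 2)) * (1 - X ^ (k + m + 2 + k + 3)) * i0
          - X ^ (k + m + 2 + 1) * (1 - X ^ (m + 2)) * (1 - X ^ (m + 1)) * i2

theorem le_tri (k : ℕ) : k ≤ tri k := by
  cases k <;> simp [tri]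

theorem jc_approx (n k m : ℕ) (h : n = k + m) :
    (X : PS5) ^ (n + 1) ∣ jc n k * eul - (-1) ^ k * X ^ tri k := by
  have hc := jc_closed n k m h
  have d : ∀ M, m ≤ M → (X : PS5) ^ (m + 1) ∣ eul - qp M := fun M hM =>
    (pow_dvd_pow _ (by omega)).trans (eul_sub_qp M)
  have hu : IsUnit (qp m * qp (n + k + 1)) := (qp_unit _).mul (qp_unit _)
  obtain ⟨v, hv⟩ := hu.exists_right_inv
  set u := (-1) ^ k * qp (2 * n + 1) * v with hudef
  have hju : jc n k = X ^ tri k * u := by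
    calc jc n k = jc n k * (qp m * qp (n + k + 1) * v) := by rw [hv, mul_one]
      _ = (jc n k * (qp m * qp (n + k + 1))) * v := by ring
      _ = _ := by rw [hc, hudef]; ring
  have huu : u * (qp m * qp (n + k + 1)) = (-1) ^ k * qp (2 * n + 1) := by
    rw [hudef, mul_assoc, mul_comm v, hv, mul_one]
  have h1 : (X : PS5) ^ (m + 1) ∣ (u * eul - (-1) ^ k) * eul := by
    have a := (d m le_rfl).mul_right (u * eul)
    have b := (d (n + k + 1) (by omega)).mul_right (u * qp m)
    have c := (d (2 * n + 1) (by omega)).mul_right ((-1) ^ k)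
    convert (a.add b).sub c using 1
    linear_combination huu
  have h2 : (X : PS5) ^ (m + 1) ∣ u * eul - (-1) ^ k := (eul_unit.dvd_mul_right).mp h1
  have h3 := mul_dvd_mul_left ((X : PS5) ^ tri k) h2
  rw [← pow_add] at h3
  refine (pow_dvd_pow _ ?_).trans (h3.trans (dvd_of_eq ?_))
  · have := le_tri k; omega
  · rw [hju]; ring

theorem eul_cube (n : ℕ) : (X : PS5) ^ (n + 1) ∣
    eul ^ 3 - ∑ k ∈ Finset.range (n + 1), (2 * (k : PS5) + 1) * ((-1) ^ k * X ^ tri k) := by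
  have h1 : (X : PS5) ^ (n + 1) ∣ ∑ k ∈ Finset.range (n + 1),
      (2 * (k : PS5) + 1) * (jc n k * eul - (-1) ^ k * X ^ tri k) := by
    refine Finset.dvd_sum fun k hk => Dvd.dvd.mul_left ?_ _
    rw [Finset.mem_range] at hk
    exact jc_approx n k (n - k) (by omega)
  have h2 := (eul_sub_qp n).mul_right (eul * (eul + qp n))
  convert h1.add h2 using 1
  have h3 := jc_sum n (n + 1) (by omega)
  simp_rw [mul_sub]
  rw [Finset.sum_sub_distrib]
  simp_rw [← mul_assoc]
  rw [← Finset.sum_mul, h3]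
  ring

theorem tri_mod (k : ℕ) : tri k % 5 = 0 ∨ tri k % 5 = 1 ∨ k % 5 = 2 := by
  have h : ∀ k, 2 * tri k = k * (k + 1) := by
    intro k
    induction k with
    | zero => rfl
    | succ k ih => simp only [tri]; linarith
  have hk := h k
  have h5 : (2 * tri k) % 5 = ((k % 5) * (k % 5 + 1)) % 5 := by
    rw [hk, Nat.mul_mod, Nat.add_mod]; simp [Nat.mul_mod, Nat.add_mod]
  have : k % 5 < 5 := Nat.mod_lt _ (by omega)
  interval_cases h : k % 5 <;> omega

theorem coeff_eul_cube (j : ℕ) (h0 : j % 5 ≠ 0) (h1 : j % 5 ≠ 1) : coeff j (eul ^ 3) = 0 := by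
  have h := X_pow_dvd_iff.mp (eul_cube j) j (by omega)
  rw [map_sub, sub_eq_zero] at h
  rw [h, map_sum]
  refine Finset.sum_eq_zero fun k _ => ?_
  have e : (2 * (k : PS5) + 1) * ((-1) ^ k * X ^ tri k)
      = C ((2 * (k : ZMod 5) + 1) * (-1) ^ k) * X ^ tri k := by
    have h2 : (C (2 : ZMod 5) : PS5) = 2 := map_ofNat C 2
    simp [mul_assoc, h2]
  rw [e, coeff_C_mul, coeff_X_pow]
  split_ifs with hj
  · rcases tri_mod k with h | h | h
    · omega
    · omega
    · have : ((2 * k + 1 : ℕ) : ZMod 5) = 0 := by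
        rw [ZMod.natCast_eq_zero_iff]; omega
      push_cast at this
      rw [this]; simp
  · simp

theorem coeff_eul (j : ℕ) (h : 3 ≤ j % 5) : coeff j eul = 0 := by
  apply coeff_pentagonalSeries_eq_zero
  rintro ⟨k, hk⟩
  have h2 := two_mul_natCast_pentagonal k
  rw [hk] at h2
  have h5 : (2 * (j : ℤ)) % 5 = ((k % 5) * (3 * (k % 5) - 1)) % 5 := by
    rw [h2]; simp [Int.mul_emod, Int.sub_emod]
  have a : k % 5 < 5 := Int.emod_lt_of_pos _ (by omega)
  have b : 0 ≤ k % 5 := Int.emod_nonneg _ (by omega)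
  interval_cases k % 5 <;> omega

theorem coeff_eul_four (j : ℕ) (h : j % 5 = 4) : coeff j (eul ^ 4) = 0 := by
  rw [pow_succ, coeff_mul]
  refine Finset.sum_eq_zero fun x hx => ?_
  rw [Finset.HasAntidiagonal.mem_antidiagonal] at hx
  by_cases h3 : 3 ≤ x.2 % 5
  · rw [coeff_eul _ h3, mul_zero]
  · rw [coeff_eul_cube, zero_mul] <;> omega

theorem coeff_qp_five (M : ℕ) : ∀ j, j % 5 ≠ 0 → coeff j (qp M ^ 5) = 0 := by
  induction M with
  | zero =>
    intro j hj
    rw [qp_zero, one_pow, coeff_one, if_neg]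
    rintro rfl; simp at hj
  | succ M ih =>
    intro j hj
    have : Fact (Nat.Prime 5) := ⟨by norm_num⟩
    have : CharP PS5 5 := charP_of_injective_ringHom (f := (C : ZMod 5 →+* PS5)) C_injective 5
    rw [qp_succ, mul_pow, sub_pow_char, one_pow, ← pow_mul, mul_sub, mul_one, map_sub, ih j hj,
      coeff_mul_X_pow']
    split_ifs
    · rw [ih _ (by omega)]; simp
    · simp

theorem coeff_eul_five (j : ℕ) (h : j % 5 ≠ 0) : coeff j (eul ^ 5) = 0 := by
  have h1 : (X : PS5) ^ (j + 1) ∣ eul ^ 5 - qp j ^ 5 :=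
    (eul_sub_qp j).trans (sub_dvd_pow_sub_pow _ _ 5)
  have h2 := X_pow_dvd_iff.mp h1 j (by omega)
  rw [map_sub, coeff_qp_five j j h, sub_zero] at h2
  exact h2

/-- The generating function of partitions. -/
noncomputable def pgen : PS5 := PowerSeries.mk fun n => (Fintype.card (Nat.Partition n) : ZMod 5)

open PowerSeries.WithPiTopology in
theorem pgen_mul_eul : pgen * eul = 1 := by
  have h1 := Nat.Partition.hasProd_powerSeriesMk_card_restricted (ZMod 5) (fun _ => True)
  have h2 := WithPiTopology.hasProd_one_sub_X_pow (ZMod 5)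
  have h3 := h1.mul h2
  have e : (PowerSeries.mk fun n =>
      ((Nat.Partition.restricted n (fun _ => True)).card : ZMod 5)) = pgen := by
    simp [pgen, Nat.Partition.restricted, Finset.card_univ]
  rw [e] at h3
  refine h3.unique ?_
  convert hasProd_one using 1
  funext i
  simp only [if_true, pow_mul]
  exact WithPiTopology.tsum_pow_mul_one_sub_of_constantCoeff_eq_zero (by simp)

theorem coeff_pgen (n : ℕ) : coeff (5 * n + 4) pgen = 0 := by
  induction n using Nat.strong_induction_on with
  | _ n ih =>
    have h : pgen * eul ^ 5 = eul ^ 4 := by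
      rw [pow_succ']; rw [← mul_assoc, pgen_mul_eul, one_mul]
    have h1 := congrArg (coeff (5 * n + 4)) h
    rw [coeff_eul_four _ (by omega), coeff_mul] at h1
    rw [Finset.sum_eq_single (5 * n + 4, 0)] at h1
    · have hu := (eul_unit.pow 5).map (constantCoeff (R := ZMod 5))
      simp only [coeff_zero_eq_constantCoeff_apply] at h1
      exact (hu.mul_left_eq_zero).mp h1
    · rintro ⟨a, b⟩ hx hne
      rw [Finset.HasAntidiagonal.mem_antidiagonal] at hx
      simp only at hx ⊢
      by_cases hb : b % 5 = 0
      · have hb0 : b ≠ 0 := by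
          rintro rfl
          apply hne
          simp only [add_zero] at hx
          rw [hx]
        have := ih ((a - 4) / 5) (by omega)
        rw [show 5 * ((a - 4) / 5) + 4 = a by omega] at this
        rw [this, zero_mul]
      · rw [coeff_eul_five _ hb, mul_zero]
    · intro hx; simp at hx

/-- Ramanujan's congruence `p(5n+4) ≡ 0 (mod 5)` for the partition function. -/
theorem partition_congruence_mod_five (n : ℕ) :
    Fintype.card (Nat.Partition (5 * n + 4)) % 5 = 0 := by
  have h := coeff_pgen n
  rw [pgen, coeff_mk, ZMod.natCast_eq_zero_iff] at h
  omega
end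

section
/- For every non-negative integer n, the partition function satisfies p(11n + 6) ≡ 0 (mod 11). -/
namespace PC11
open PowerSeries

abbrev K := ZMod 11

instance : Fact (Nat.Prime 11) := ⟨by norm_num⟩

noncomputable def pr (r : ℕ) (f : K⟦X⟧) : K⟦X⟧ :=
  PowerSeries.mk fun n => if n % 11 = r then coeff n f else 0

lemma coeff_pr (r n : ℕ) (f : K⟦X⟧) : coeff n (pr r f) = if n % 11 = r then coeff n f else 0 := by
  simp [pr]

lemma pr_mul (r : ℕ) (hr : r < 11) (f g : K⟦X⟧) :
    pr r (f * g) = ∑ s ∈ Finset.range 11, pr s f * pr ((r + 11 - s) % 11) g := by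
  ext n
  rw [coeff_pr, map_sum]
  simp_rw [coeff_mul, coeff_pr]
  rw [Finset.sum_comm]
  split_ifs with h
  · refine Finset.sum_congr rfl fun p hp => ?_
    rw [Finset.HasAntidiagonal.mem_antidiagonal] at hp
    rw [Finset.sum_eq_single (p.1 % 11)]
    · rw [if_pos rfl, if_pos (by omega)]
    · intro b _ hb
      rw [if_neg (Ne.symm hb), zero_mul]
    · intro hb
      exact absurd (Finset.mem_range.2 (Nat.mod_lt _ (by norm_num))) hb
  · symm
    refine Finset.sum_eq_zero fun p hp => Finset.sum_eq_zero fun s hs => ?_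
    rw [Finset.HasAntidiagonal.mem_antidiagonal] at hp
    rw [Finset.mem_range] at hs
    split_ifs with h1 h2
    · omega
    all_goals simp

lemma pr_sum (r : ℕ) (f : K⟦X⟧) (n : ℕ) (h : pr r f = 0) (hn : n % 11 = r) : coeff n f = 0 := by
  have := coeff_pr r n f
  simpa [h, hn, eq_comm] using this

lemma pr_eq_zero (r : ℕ) (f : K⟦X⟧) (h : ∀ n, n % 11 = r → coeff n f = 0) : pr r f = 0 := by
  ext n
  rw [coeff_pr]
  split_ifs with hn
  · simpa using h n hn
  · simp

lemma coeff_pow11 (f : K⟦X⟧) (n : ℕ) (hn : ¬ 11 ∣ n) : coeff n (f ^ 11) = 0 := by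
  have h := MvPowerSeries.map_frobenius_expand (σ := Unit) (R := K) 11 (by norm_num) (f := f)
  have h2 : (PowerSeries.map (frobenius K 11) (PowerSeries.expand 11 (by norm_num) f)) = f ^ 11 := h
  rw [← h2, coeff_map, coeff_expand_of_not_dvd _ _ _ hn, map_zero]

noncomputable def E : K⟦X⟧ := pentagonalSeries K

lemma coeff_E (n : ℕ) (hn : n % 11 = 3 ∨ n % 11 = 6 ∨ n % 11 = 8 ∨ n % 11 = 9 ∨ n % 11 = 10) :
    coeff n E = 0 := by
  apply coeff_pentagonalSeries_eq_zero
  rintro ⟨k, rfl⟩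
  have h := two_mul_natCast_pentagonal k
  have h2 : (2 * (pentagonal k : ℤ)) % 11 = ((k % 11) * (3 * (k % 11) - 1)) % 11 := by
    rw [h]; simp [Int.mul_emod, Int.sub_emod]
  have h3 : 0 ≤ k % 11 := by omega
  have h4 : k % 11 < 11 := by omega
  generalize k % 11 = l at *
  interval_cases l <;> omega

open scoped PowerSeries.WithPiTopology in
lemma P_mul_E : (PowerSeries.mk fun n => (Fintype.card (Nat.Partition n) : K)) * E = 1 := by
  let _ : TopologicalSpace K := ⊥
  have _ : DiscreteTopology K := ⟨rfl⟩
  have h1 := Nat.Partition.hasProd_powerSeriesMk_card_restricted K (fun _ => True)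
  have h2 := PowerSeries.WithPiTopology.hasProd_one_sub_X_pow K
  have h3 := h1.mul h2
  have h4 : (fun i : ℕ => (if True then ∑' j : ℕ, (X : K⟦X⟧) ^ ((i + 1) * j) else 1) * (1 - X ^ (i + 1))) = fun _ => 1 := by
    funext i
    simp_rw [if_true, pow_mul]
    rw [PowerSeries.WithPiTopology.tsum_pow_mul_one_sub_of_constantCoeff_eq_zero (by simp)]
  rw [h4] at h3
  have h5 := h3.unique hasProd_one
  rw [← h5]
  simp [Nat.Partition.restricted, E]

set_option linter.unusedSimpArgs false in
lemma key (f : K⟦X⟧) (h2 : pr 2 f = 0) (h4 : pr 4 f = 0) (h5 : pr 5 f = 0) (h7 : pr 7 f = 0)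
    (h8 : pr 8 f = 0) (h9 : pr 9 f = 0)
    (g3 : pr 3 (f ^ 4) = 0) (g6 : pr 6 (f ^ 4) = 0) (g8 : pr 8 (f ^ 4) = 0)
    (g9 : pr 9 (f ^ 4) = 0) (g10 : pr 10 (f ^ 4) = 0) : pr 6 (f ^ 7) = 0 := by
  have h11 : (11 : K⟦X⟧) = 0 := by
    have : ((11 : K) : K) = 0 := by decide
    have h := congrArg (algebraMap K K⟦X⟧) this
    rwa [map_ofNat, map_zero] at h
  obtain ⟨a, ha⟩ : ∃ a, a = pr 0 f := ⟨_, rfl⟩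
  obtain ⟨b, hb⟩ : ∃ a, a = pr 1 f := ⟨_, rfl⟩
  obtain ⟨c, hc⟩ : ∃ a, a = pr 3 f := ⟨_, rfl⟩
  obtain ⟨d, hd⟩ : ∃ a, a = pr 6 f := ⟨_, rfl⟩
  obtain ⟨e, he⟩ : ∃ a, a = pr 10 f := ⟨_, rfl⟩
  have p20 : pr 0 (f ^ 2) = 1*a*a + 2*b*e := by
    rw [show f ^ 2 = f * f by ring, pr_mul _ (by norm_num)]
    simp only [Finset.sum_range_succ, Finset.sum_range_zero, Nat.reduceAdd, Nat.reduceSub,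
      Nat.reduceMod, h2, h4, h5, h7, h8, h9, ← ha, ← hb, ← hc, ← hd, ← he]
    ring
  have p21 : pr 1 (f ^ 2) = 2*a*b + 1*d*d := by
    rw [show f ^ 2 = f * f by ring, pr_mul _ (by norm_num)]
    simp only [Finset.sum_range_succ, Finset.sum_range_zero, Nat.reduceAdd, Nat.reduceSub,
      Nat.reduceMod, h2, h4, h5, h7, h8, h9, ← ha, ← hb, ← hc, ← hd, ← he]
    ring
  have p22 : pr 2 (f ^ 2) = 1*b*b + 2*c*e := by
    rw [show f ^ 2 = f * f by ring, pr_mul _ (by norm_num)]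
    simp only [Finset.sum_range_succ, Finset.sum_range_zero, Nat.reduceAdd, Nat.reduceSub,
      Nat.reduceMod, h2, h4, h5, h7, h8, h9, ← ha, ← hb, ← hc, ← hd, ← he]
    ring
  have p23 : pr 3 (f ^ 2) = 2*a*c := by
    rw [show f ^ 2 = f * f by ring, pr_mul _ (by norm_num)]
    simp only [Finset.sum_range_succ, Finset.sum_range_zero, Nat.reduceAdd, Nat.reduceSub,
      Nat.reduceMod, h2, h4, h5, h7, h8, h9, ← ha, ← hb, ← hc, ← hd, ← he]
    ring
  have p24 : pr 4 (f ^ 2) = 2*b*c := by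
    rw [show f ^ 2 = f * f by ring, pr_mul _ (by norm_num)]
    simp only [Finset.sum_range_succ, Finset.sum_range_zero, Nat.reduceAdd, Nat.reduceSub,
      Nat.reduceMod, h2, h4, h5, h7, h8, h9, ← ha, ← hb, ← hc, ← hd, ← he]
    ring
  have p25 : pr 5 (f ^ 2) = 2*d*e := by
    rw [show f ^ 2 = f * f by ring, pr_mul _ (by norm_num)]
    simp only [Finset.sum_range_succ, Finset.sum_range_zero, Nat.reduceAdd, Nat.reduceSub,
      Nat.reduceMod, h2, h4, h5, h7, h8, h9, ← ha, ← hb, ← hc, ← hd, ← he]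
    ring
  have p26 : pr 6 (f ^ 2) = 2*a*d + 1*c*c := by
    rw [show f ^ 2 = f * f by ring, pr_mul _ (by norm_num)]
    simp only [Finset.sum_range_succ, Finset.sum_range_zero, Nat.reduceAdd, Nat.reduceSub,
      Nat.reduceMod, h2, h4, h5, h7, h8, h9, ← ha, ← hb, ← hc, ← hd, ← he]
    ring
  have p27 : pr 7 (f ^ 2) = 2*b*d := by
    rw [show f ^ 2 = f * f by ring, pr_mul _ (by norm_num)]
    simp only [Finset.sum_range_succ, Finset.sum_range_zero, Nat.reduceAdd, Nat.reduceSub,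
      Nat.reduceMod, h2, h4, h5, h7, h8, h9, ← ha, ← hb, ← hc, ← hd, ← he]
    ring
  have p28 : pr 8 (f ^ 2) = 0 := by
    rw [show f ^ 2 = f * f by ring, pr_mul _ (by norm_num)]
    simp only [Finset.sum_range_succ, Finset.sum_range_zero, Nat.reduceAdd, Nat.reduceSub,
      Nat.reduceMod, h2, h4, h5, h7, h8, h9, ← ha, ← hb, ← hc, ← hd, ← he]
    ring
  have p29 : pr 9 (f ^ 2) = 2*c*d + 1*e*e := by
    rw [show f ^ 2 = f * f by ring, pr_mul _ (by norm_num)]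
    simp only [Finset.sum_range_succ, Finset.sum_range_zero, Nat.reduceAdd, Nat.reduceSub,
      Nat.reduceMod, h2, h4, h5, h7, h8, h9, ← ha, ← hb, ← hc, ← hd, ← he]
    ring
  have p210 : pr 10 (f ^ 2) = 2*a*e := by
    rw [show f ^ 2 = f * f by ring, pr_mul _ (by norm_num)]
    simp only [Finset.sum_range_succ, Finset.sum_range_zero, Nat.reduceAdd, Nat.reduceSub,
      Nat.reduceMod, h2, h4, h5, h7, h8, h9, ← ha, ← hb, ← hc, ← hd, ← he]
    ring
  have p30 : pr 0 (f ^ 3) = 1*a*a*a + 6*a*b*e + 3*d*d*e := by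
    rw [show f ^ 3 = f ^ 2 * f by ring, pr_mul _ (by norm_num)]
    simp only [Finset.sum_range_succ, Finset.sum_range_zero, Nat.reduceAdd, Nat.reduceSub,
      Nat.reduceMod, h2, h4, h5, h7, h8, h9, ← ha, ← hb, ← hc, ← hd, ← he, p20, p21, p22, p23, p24, p25, p26, p27, p28, p29, p210]
    ring
  have p31 : pr 1 (f ^ 3) = 3*a*a*b + 3*a*d*d + 3*b*b*e + 3*c*c*d + 3*c*e*e := by
    rw [show f ^ 3 = f ^ 2 * f by ring, pr_mul _ (by norm_num)]
    simp only [Finset.sum_range_succ, Finset.sum_range_zero, Nat.reduceAdd, Nat.reduceSub,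
      Nat.reduceMod, h2, h4, h5, h7, h8, h9, ← ha, ← hb, ← hc, ← hd, ← he, p20, p21, p22, p23, p24, p25, p26, p27, p28, p29, p210]
    ring
  have p32 : pr 2 (f ^ 3) = 3*a*b*b + 6*a*c*e + 3*b*d*d := by
    rw [show f ^ 3 = f ^ 2 * f by ring, pr_mul _ (by norm_num)]
    simp only [Finset.sum_range_succ, Finset.sum_range_zero, Nat.reduceAdd, Nat.reduceSub,
      Nat.reduceMod, h2, h4, h5, h7, h8, h9, ← ha, ← hb, ← hc, ← hd, ← he, p20, p21, p22, p23, p24, p25, p26, p27, p28, p29, p210]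
    ring
  have p33 : pr 3 (f ^ 3) = 3*a*a*c + 1*b*b*b + 6*b*c*e := by
    rw [show f ^ 3 = f ^ 2 * f by ring, pr_mul _ (by norm_num)]
    simp only [Finset.sum_range_succ, Finset.sum_range_zero, Nat.reduceAdd, Nat.reduceSub,
      Nat.reduceMod, h2, h4, h5, h7, h8, h9, ← ha, ← hb, ← hc, ← hd, ← he, p20, p21, p22, p23, p24, p25, p26, p27, p28, p29, p210]
    ring
  have p34 : pr 4 (f ^ 3) = 6*a*b*c + 3*c*d*d + 3*d*e*e := by
    rw [show f ^ 3 = f ^ 2 * f by ring, pr_mul _ (by norm_num)]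
    simp only [Finset.sum_range_succ, Finset.sum_range_zero, Nat.reduceAdd, Nat.reduceSub,
      Nat.reduceMod, h2, h4, h5, h7, h8, h9, ← ha, ← hb, ← hc, ← hd, ← he, p20, p21, p22, p23, p24, p25, p26, p27, p28, p29, p210]
    ring
  have p35 : pr 5 (f ^ 3) = 6*a*d*e + 3*b*b*c + 3*c*c*e := by
    rw [show f ^ 3 = f ^ 2 * f by ring, pr_mul _ (by norm_num)]
    simp only [Finset.sum_range_succ, Finset.sum_range_zero, Nat.reduceAdd, Nat.reduceSub,
      Nat.reduceMod, h2, h4, h5, h7, h8, h9, ← ha, ← hb, ← hc, ← hd, ← he, p20, p21, p22, p23, p24, p25, p26, p27, p28, p29, p210]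
    ring
  have p36 : pr 6 (f ^ 3) = 3*a*a*d + 3*a*c*c + 6*b*d*e := by
    rw [show f ^ 3 = f ^ 2 * f by ring, pr_mul _ (by norm_num)]
    simp only [Finset.sum_range_succ, Finset.sum_range_zero, Nat.reduceAdd, Nat.reduceSub,
      Nat.reduceMod, h2, h4, h5, h7, h8, h9, ← ha, ← hb, ← hc, ← hd, ← he, p20, p21, p22, p23, p24, p25, p26, p27, p28, p29, p210]
    ring
  have p37 : pr 7 (f ^ 3) = 6*a*b*d + 3*b*c*c + 1*d*d*d := by
    rw [show f ^ 3 = f ^ 2 * f by ring, pr_mul _ (by norm_num)]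
    simp only [Finset.sum_range_succ, Finset.sum_range_zero, Nat.reduceAdd, Nat.reduceSub,
      Nat.reduceMod, h2, h4, h5, h7, h8, h9, ← ha, ← hb, ← hc, ← hd, ← he, p20, p21, p22, p23, p24, p25, p26, p27, p28, p29, p210]
    ring
  have p38 : pr 8 (f ^ 3) = 3*b*b*d + 6*c*d*e + 1*e*e*e := by
    rw [show f ^ 3 = f ^ 2 * f by ring, pr_mul _ (by norm_num)]
    simp only [Finset.sum_range_succ, Finset.sum_range_zero, Nat.reduceAdd, Nat.reduceSub,
      Nat.reduceMod, h2, h4, h5, h7, h8, h9, ← ha, ← hb, ← hc, ← hd, ← he, p20, p21, p22, p23, p24, p25, p26, p27, p28, p29, p210]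
    ring
  have p39 : pr 9 (f ^ 3) = 6*a*c*d + 3*a*e*e + 1*c*c*c := by
    rw [show f ^ 3 = f ^ 2 * f by ring, pr_mul _ (by norm_num)]
    simp only [Finset.sum_range_succ, Finset.sum_range_zero, Nat.reduceAdd, Nat.reduceSub,
      Nat.reduceMod, h2, h4, h5, h7, h8, h9, ← ha, ← hb, ← hc, ← hd, ← he, p20, p21, p22, p23, p24, p25, p26, p27, p28, p29, p210]
    ring
  have p310 : pr 10 (f ^ 3) = 3*a*a*e + 6*b*c*d + 3*b*e*e := by
    rw [show f ^ 3 = f ^ 2 * f by ring, pr_mul _ (by norm_num)]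
    simp only [Finset.sum_range_succ, Finset.sum_range_zero, Nat.reduceAdd, Nat.reduceSub,
      Nat.reduceMod, h2, h4, h5, h7, h8, h9, ← ha, ← hb, ← hc, ← hd, ← he, p20, p21, p22, p23, p24, p25, p26, p27, p28, p29, p210]
    ring
  have p40 : pr 0 (f ^ 4) = 1*a*a*a*a + 12*a*a*b*e + 12*a*d*d*e + 12*b*b*c*d + 6*b*b*e*e + 12*c*c*d*e + 4*c*e*e*e := by
    rw [show f ^ 4 = f ^ 2 * f ^ 2 by ring, pr_mul _ (by norm_num)]
    simp only [Finset.sum_range_succ, Finset.sum_range_zero, Nat.reduceAdd, Nat.reduceSub,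
      Nat.reduceMod, h2, h4, h5, h7, h8, h9, ← ha, ← hb, ← hc, ← hd, ← he, p20, p21, p22, p23, p24, p25, p26, p27, p28, p29, p210]
    ring
  have p41 : pr 1 (f ^ 4) = 4*a*a*a*b + 6*a*a*d*d + 12*a*b*b*e + 12*a*c*c*d + 12*a*c*e*e + 12*b*d*d*e + 1*c*c*c*c := by
    rw [show f ^ 4 = f ^ 2 * f ^ 2 by ring, pr_mul _ (by norm_num)]
    simp only [Finset.sum_range_succ, Finset.sum_range_zero, Nat.reduceAdd, Nat.reduceSub,
      Nat.reduceMod, h2, h4, h5, h7, h8, h9, ← ha, ← hb, ← hc, ← hd, ← he, p20, p21, p22, p23, p24, p25, p26, p27, p28, p29, p210]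
    ring
  have p42 : pr 2 (f ^ 4) = 6*a*a*b*b + 12*a*a*c*e + 12*a*b*d*d + 4*b*b*b*e + 12*b*c*c*d + 12*b*c*e*e + 1*d*d*d*d := by
    rw [show f ^ 4 = f ^ 2 * f ^ 2 by ring, pr_mul _ (by norm_num)]
    simp only [Finset.sum_range_succ, Finset.sum_range_zero, Nat.reduceAdd, Nat.reduceSub,
      Nat.reduceMod, h2, h4, h5, h7, h8, h9, ← ha, ← hb, ← hc, ← hd, ← he, p20, p21, p22, p23, p24, p25, p26, p27, p28, p29, p210]
    ring
  have p43 : pr 3 (f ^ 4) = 4*a*a*a*c + 4*a*b*b*b + 24*a*b*c*e + 6*b*b*d*d + 12*c*d*d*e + 4*d*e*e*e := by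
    rw [show f ^ 4 = f ^ 2 * f ^ 2 by ring, pr_mul _ (by norm_num)]
    simp only [Finset.sum_range_succ, Finset.sum_range_zero, Nat.reduceAdd, Nat.reduceSub,
      Nat.reduceMod, h2, h4, h5, h7, h8, h9, ← ha, ← hb, ← hc, ← hd, ← he, p20, p21, p22, p23, p24, p25, p26, p27, p28, p29, p210]
    ring
  have p44 : pr 4 (f ^ 4) = 12*a*a*b*c + 12*a*c*d*d + 12*a*d*e*e + 1*b*b*b*b + 12*b*b*c*e + 4*c*c*c*d + 6*c*c*e*e := by
    rw [show f ^ 4 = f ^ 2 * f ^ 2 by ring, pr_mul _ (by norm_num)]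
    simp only [Finset.sum_range_succ, Finset.sum_range_zero, Nat.reduceAdd, Nat.reduceSub,
      Nat.reduceMod, h2, h4, h5, h7, h8, h9, ← ha, ← hb, ← hc, ← hd, ← he, p20, p21, p22, p23, p24, p25, p26, p27, p28, p29, p210]
    ring
  have p45 : pr 5 (f ^ 4) = 12*a*a*d*e + 12*a*b*b*c + 12*a*c*c*e + 12*b*c*d*d + 12*b*d*e*e := by
    rw [show f ^ 4 = f ^ 2 * f ^ 2 by ring, pr_mul _ (by norm_num)]
    simp only [Finset.sum_range_succ, Finset.sum_range_zero, Nat.reduceAdd, Nat.reduceSub,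
      Nat.reduceMod, h2, h4, h5, h7, h8, h9, ← ha, ← hb, ← hc, ← hd, ← he, p20, p21, p22, p23, p24, p25, p26, p27, p28, p29, p210]
    ring
  have p46 : pr 6 (f ^ 4) = 4*a*a*a*d + 6*a*a*c*c + 24*a*b*d*e + 4*b*b*b*c + 12*b*c*c*e + 4*d*d*d*e := by
    rw [show f ^ 4 = f ^ 2 * f ^ 2 by ring, pr_mul _ (by norm_num)]
    simp only [Finset.sum_range_succ, Finset.sum_range_zero, Nat.reduceAdd, Nat.reduceSub,
      Nat.reduceMod, h2, h4, h5, h7, h8, h9, ← ha, ← hb, ← hc, ← hd, ← he, p20, p21, p22, p23, p24, p25, p26, p27, p28, p29, p210]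
    ring
  have p47 : pr 7 (f ^ 4) = 12*a*a*b*d + 12*a*b*c*c + 4*a*d*d*d + 12*b*b*d*e + 6*c*c*d*d + 12*c*d*e*e + 1*e*e*e*e := by
    rw [show f ^ 4 = f ^ 2 * f ^ 2 by ring, pr_mul _ (by norm_num)]
    simp only [Finset.sum_range_succ, Finset.sum_range_zero, Nat.reduceAdd, Nat.reduceSub,
      Nat.reduceMod, h2, h4, h5, h7, h8, h9, ← ha, ← hb, ← hc, ← hd, ← he, p20, p21, p22, p23, p24, p25, p26, p27, p28, p29, p210]
    ring
  have p48 : pr 8 (f ^ 4) = 12*a*b*b*d + 24*a*c*d*e + 4*a*e*e*e + 6*b*b*c*c + 4*b*d*d*d + 4*c*c*c*e := by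
    rw [show f ^ 4 = f ^ 2 * f ^ 2 by ring, pr_mul _ (by norm_num)]
    simp only [Finset.sum_range_succ, Finset.sum_range_zero, Nat.reduceAdd, Nat.reduceSub,
      Nat.reduceMod, h2, h4, h5, h7, h8, h9, ← ha, ← hb, ← hc, ← hd, ← he, p20, p21, p22, p23, p24, p25, p26, p27, p28, p29, p210]
    ring
  have p49 : pr 9 (f ^ 4) = 12*a*a*c*d + 6*a*a*e*e + 4*a*c*c*c + 4*b*b*b*d + 24*b*c*d*e + 4*b*e*e*e := by
    rw [show f ^ 4 = f ^ 2 * f ^ 2 by ring, pr_mul _ (by norm_num)]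
    simp only [Finset.sum_range_succ, Finset.sum_range_zero, Nat.reduceAdd, Nat.reduceSub,
      Nat.reduceMod, h2, h4, h5, h7, h8, h9, ← ha, ← hb, ← hc, ← hd, ← he, p20, p21, p22, p23, p24, p25, p26, p27, p28, p29, p210]
    ring
  have p410 : pr 10 (f ^ 4) = 4*a*a*a*e + 24*a*b*c*d + 12*a*b*e*e + 4*b*c*c*c + 4*c*d*d*d + 6*d*d*e*e := by
    rw [show f ^ 4 = f ^ 2 * f ^ 2 by ring, pr_mul _ (by norm_num)]
    simp only [Finset.sum_range_succ, Finset.sum_range_zero, Nat.reduceAdd, Nat.reduceSub,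
      Nat.reduceMod, h2, h4, h5, h7, h8, h9, ← ha, ← hb, ← hc, ← hd, ← he, p20, p21, p22, p23, p24, p25, p26, p27, p28, p29, p210]
    ring
  have e3 := g3
  rw [p43] at e3
  have e6 := g6
  rw [p46] at e6
  have e8 := g8
  rw [p48] at e8
  have e9 := g9
  rw [p49] at e9
  have e10 := g10
  rw [p410] at e10
  rw [show f ^ 7 = f ^ 4 * f ^ 3 by ring, pr_mul _ (by norm_num)]
  simp only [Finset.sum_range_succ, Finset.sum_range_zero, Nat.reduceAdd, Nat.reduceSub,
    Nat.reduceMod, p30, p31, p32, p33, p34, p35, p36, p37, p38, p39, p310, p40, p41, p42, p43, p44, p45, p46, p47, p48, p49, p410]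
  linear_combination (4*a*a*c + 10*b*b*b + 10*b*c*e) * e3 + (10*a*a*a + 10*a*b*e + 4*d*d*e) * e6 + (10*a*c*d + 4*a*e*e + 10*c*c*c) * e8 + (4*b*b*d + 10*c*d*e + 10*e*e*e) * e9 + (10*a*b*d + 4*b*c*c + 10*d*d*d) * e10 + ((-3)*a*a*a*a*a*a*d + (-5)*a*a*a*a*a*c*c + (-10)*a*a*a*a*b*d*e + (4)*a*a*a*b*b*b*c + (8)*a*a*a*b*c*c*e + (4)*a*a*a*d*d*d*e + (18)*a*a*b*b*c*d*d + (18)*a*a*b*b*d*e*e + (18)*a*a*c*c*d*d*e + (8)*a*a*c*d*e*e*e + (-5)*a*a*e*e*e*e*e + (-3)*a*b*b*b*b*b*b + (-10)*a*b*b*b*b*c*e + (8)*a*b*b*c*c*c*d + (18)*a*b*b*c*c*e*e + (-10)*a*b*c*d*d*d*d + (8)*a*b*d*d*d*e*e + (-10)*a*c*c*c*c*d*e + (4)*a*c*c*c*e*e*e + (-5)*b*b*b*b*b*d*d + (8)*b*b*b*c*d*d*e + (4)*b*b*b*d*e*e*e + (-5)*b*b*c*c*c*c*c + (4)*b*c*c*c*d*d*d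 + (18)*b*c*c*d*d*e*e + (-10)*b*c*d*e*e*e*e + (-3)*b*e*e*e*e*e*e + (-3)*c*c*c*c*c*c*e + (-3)*c*d*d*d*d*d*d + (-5)*d*d*d*d*d*e*e) * h11
/-- Gaussian binomial coefficients. -/
noncomputable def gb : ℕ → ℕ → K⟦X⟧
  | _, 0 => 1
  | 0, _ + 1 => 0
  | N + 1, j + 1 => gb N (j + 1) + X ^ (N - j) * gb N j

/-- Truncated Euler product. -/
noncomputable def Q (n : ℕ) : K⟦X⟧ := ∏ i ∈ Finset.range n, (1 - X ^ (i + 1))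

lemma Q_succ (n : ℕ) : Q (n + 1) = Q n * (1 - X ^ (n + 1)) := Finset.prod_range_succ _ _

lemma gb_zero (N : ℕ) : gb N 0 = 1 := by cases N <;> rfl

lemma gb_succ (N j : ℕ) : gb (N + 1) (j + 1) = gb N (j + 1) + X ^ (N - j) * gb N j := rfl

lemma gb_gt (N j : ℕ) (h : N < j) : gb N j = 0 := by
  induction N generalizing j with
  | zero => obtain ⟨j, rfl⟩ : ∃ i, j = i + 1 := ⟨j - 1, by omega⟩; rfl
  | succ N ih =>
    obtain ⟨j, rfl⟩ : ∃ i, j = i + 1 := ⟨j - 1, by omega⟩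
    rw [gb_succ, ih _ (by omega), ih _ (by omega)]; simp

lemma gb_Q (N j l : ℕ) (h : N = j + l) : gb N j * (Q j * Q l) = Q N := by
  induction N generalizing j l with
  | zero =>
    obtain ⟨rfl, rfl⟩ : j = 0 ∧ l = 0 := by omega
    simp [gb_zero, Q]
  | succ N ih =>
    rcases j with _ | j
    · obtain rfl : l = N + 1 := by omega
      simp [gb_zero, Q]
    rw [gb_succ]
    have h1 := ih j l (by omega)
    have e : N - j = l := by omega
    rw [e]
    rcases l with _ | l
    · rw [gb_gt N (j+1) (by omega)]
      obtain rfl : N = j := by omega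
      rw [Q_succ]
      linear_combination (1 - X ^ (N + 1)) * h1
    · have h2 := ih (j + 1) l (by omega)
      rw [Q_succ] at h1 h2 ⊢
      rw [Q_succ N, Q_succ l]
      obtain rfl : N = j + (l + 1) := by omega
      linear_combination (1 - X ^ (l + 1)) * h2 + X ^ (l + 1) * (1 - X ^ (j + 1)) * h1

lemma qbinom_coeff (y : K⟦X⟧) (N k : ℕ) :
    (∏ i ∈ Finset.range N,
      (Polynomial.C y - Polynomial.X * Polynomial.C ((X : K⟦X⟧) ^ i))).coeff k =
      (-1) ^ k * X ^ (k.choose 2) * gb N k * y ^ (N - k) := by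
  induction N generalizing k with
  | zero =>
    rcases k with _ | k
    · simp [gb_zero]
    · simp [gb_gt, Polynomial.coeff_one]
  | succ N ih =>
    rw [Finset.prod_range_succ, mul_sub, ← mul_assoc, Polynomial.coeff_sub, Polynomial.coeff_mul_C,
      Polynomial.coeff_mul_C, ih]
    rcases k with _ | k
    · simp [gb_zero, pow_succ]
    · rw [Polynomial.coeff_mul_X, ih, gb_succ, Nat.add_sub_add_right, Nat.choose_succ_succ' k 1,
        Nat.choose_one_right]
      rcases lt_trichotomy N k with h | rfl | h
      · rw [gb_gt N k h, gb_gt N (k + 1) (by omega)]; ring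
      · rw [gb_gt N (N + 1) (by omega)]
        simp
        ring
      · obtain ⟨m, rfl⟩ : ∃ m, N = k + 1 + m := ⟨N - (k + 1), by omega⟩
        rw [show k + 1 + m - (k + 1) = m by omega, show k + 1 + m - k = m + 1 by omega]
        ring

lemma qbinom (y : K⟦X⟧) (N : ℕ) :
    ∏ i ∈ Finset.range N, (Polynomial.C y - Polynomial.X * Polynomial.C ((X : K⟦X⟧) ^ i)) =
      ∑ j ∈ Finset.range (N + 1),
        Polynomial.C ((-1) ^ j * X ^ (j.choose 2) * gb N j * y ^ (N - j)) * Polynomial.X ^ j := by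
  ext1 k
  rw [qbinom_coeff, Polynomial.finsetSum_coeff]
  simp_rw [Polynomial.coeff_C_mul_X_pow]
  rw [Finset.sum_ite_eq]
  split_ifs with h
  · rfl
  · rw [gb_gt N k (by simpa using h)]; simp

lemma isUnit_Q (n : ℕ) : IsUnit (Q n) := by
  rw [PowerSeries.isUnit_iff_constantCoeff]
  simp [Q, map_prod]

lemma Q_dvd (n m : ℕ) (h : n ≤ m) : (X : K⟦X⟧) ^ (n + 1) ∣ Q m - Q n := by
  induction m, h using Nat.le_induction with
  | base => simp
  | succ m hm ih =>
    rw [Q_succ, show Q m * (1 - X ^ (m + 1)) - Q n = (Q m - Q n) - Q m * X ^ (m + 1) by ring]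
    exact dvd_sub ih (Dvd.dvd.mul_left (pow_dvd_pow _ (by omega)) _)

lemma E_dvd (n : ℕ) : (X : K⟦X⟧) ^ (n + 1) ∣ E - Q n := by
  rw [X_pow_dvd_iff]
  intro m hm
  obtain ⟨s, hs⟩ := Filter.eventually_atTop.1 (coeff_prod_one_sub_X_pow_eventually_eq K m)
  obtain ⟨M, hM⟩ : ∃ M, s ⊆ Finset.range M := s.exists_nat_subset_range
  have h1 := hs (Finset.range (max M n)) (hM.trans (Finset.range_subset_range.2 (le_max_left _ _)))
  have h2 := X_pow_dvd_iff.1 (Q_dvd n (max M n) (le_max_right _ _)) m hm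
  rw [map_sub] at h2 ⊢
  rw [← h2]
  unfold E
  rw [← h1]; rfl

lemma Q_shift (n m : ℕ) : ∏ i ∈ Finset.range n, ((X : K⟦X⟧) ^ m - X ^ (m + 1 + i)) = X ^ (m * n) * Q n := by
  rw [Q, mul_comm m n, mul_comm n m, pow_mul, ← Finset.card_range n, ← Finset.prod_const, Finset.card_range, ← Finset.prod_mul_distrib]
  refine Finset.prod_congr rfl fun i _ => by ring

lemma Q_refl (n : ℕ) : ∏ i ∈ Finset.range n, ((X : K⟦X⟧) ^ n - X ^ i) =
    (-1) ^ n * X ^ (n.choose 2) * Q n := by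
  induction n with
  | zero => simp [Q]
  | succ n ih =>
    rw [Finset.prod_range_succ']
    have : ∏ k ∈ Finset.range n, ((X : K⟦X⟧) ^ (n + 1) - X ^ (k + 1)) = X ^ n * ∏ k ∈ Finset.range n, ((X : K⟦X⟧) ^ n - X ^ k) := by
      have h : (X : K⟦X⟧) ^ n = ∏ _k ∈ Finset.range n, (X : K⟦X⟧) := by simp
      conv_rhs => enter [1]; rw [h]
      rw [← Finset.prod_mul_distrib]
      refine Finset.prod_congr rfl fun i _ => by ring
    rw [this, ih, Q_succ, Nat.choose_succ_succ']
    simp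
    ring

lemma gb_symm (n k : ℕ) (h : k ≤ n) : gb (2 * n + 1) (n + 1 + k) = gb (2 * n + 1) (n - k) := by
  have h1 := gb_Q (2 * n + 1) (n + 1 + k) (n - k) (by omega)
  have h2 := gb_Q (2 * n + 1) (n - k) (n + 1 + k) (by omega)
  rw [← h2, mul_comm (Q (n - k))] at h1
  exact ((isUnit_Q _).mul (isUnit_Q _)).mul_right_cancel h1

lemma deriv_sum (n : ℕ) :
    ∑ j ∈ Finset.range (2 * n + 1 + 1),
      ((-1) ^ j * X ^ (j.choose 2) * gb (2 * n + 1) j * (X ^ n) ^ (2 * n + 1 - j)) * (j : K⟦X⟧) =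
    - X ^ n * (((-1) ^ n * X ^ (n.choose 2) * Q n) * (X ^ (n * n) * Q n)) := by
  have h := qbinom (X ^ n) (2 * n + 1)
  have h' := congrArg (fun p => (Polynomial.derivative p).eval 1) h
  rw [← Q_refl, ← Q_shift, Polynomial.derivative_sum, Polynomial.eval_finsetSum] at *
  have e : ∀ j : ℕ, ∀ a : K⟦X⟧, Polynomial.eval 1 (Polynomial.derivative
      (Polynomial.C a * Polynomial.X ^ j)) = a * (j : K⟦X⟧) := by
    intro j a
    rw [Polynomial.derivative_C_mul_X_pow]
    simp
  simp_rw [e] at h'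
  rw [← h', show 2 * n + 1 = n + (n + 1) by ring, Finset.prod_range_add,
    Finset.prod_range_succ' _ n]
  simp only [Polynomial.derivative_mul, Polynomial.eval_add, Polynomial.eval_mul, Polynomial.eval_prod,
    Polynomial.eval_sub, Polynomial.eval_C, Polynomial.eval_X, one_mul, add_zero, sub_self, mul_zero,
    Polynomial.derivative_sub, Polynomial.derivative_C, Polynomial.derivative_X, zero_add, zero_sub,
    Polynomial.eval_neg]
  have : ∏ x ∈ Finset.range n, ((X : K⟦X⟧) ^ n - X ^ (n + (x + 1))) =
      ∏ x ∈ Finset.range n, ((X : K⟦X⟧) ^ n - X ^ (n + 1 + x)) :=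
    Finset.prod_congr rfl fun x _ => by rw [show n + (x + 1) = n + 1 + x by omega]
  rw [this]
  ring

lemma two_choose (n : ℕ) : ((n + 1).choose 2) * 2 = n * (n + 1) := by
  rw [Nat.choose_two_right, Nat.div_mul_cancel (Nat.even_mul_pred_self (n+1)).two_dvd,
    Nat.add_sub_cancel]
  ring

lemma jacobi_fin (n : ℕ) : Q n ^ 2 = ∑ k ∈ Finset.range (n + 1),
    (-1) ^ k * (2 * (k : K⟦X⟧) + 1) * X ^ ((k + 1).choose 2) * gb (2 * n + 1) (n - k) := by
  have h := deriv_sum n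
  rw [show 2 * n + 1 + 1 = (n + 1) + (n + 1) by ring, Finset.sum_range_add,
    ← Finset.sum_range_reflect _ (n + 1), ← Finset.sum_add_distrib] at h
  have hX : (-1 : K⟦X⟧) ^ (n + 1) * X ^ (n.choose 2 + n + n * n) ≠ 0 :=
    mul_ne_zero (pow_ne_zero _ (by simp)) (pow_ne_zero _ X_ne_zero)
  apply mul_left_cancel₀ hX
  rw [Finset.mul_sum]
  refine Eq.trans ?_ (h.symm.trans ?_)
  · ring
  · refine Finset.sum_congr rfl fun k hk => ?_
    have hk' : k ≤ n := by simpa [Nat.lt_succ_iff] using hk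
    rw [gb_symm n k hk']
    obtain ⟨m, rfl⟩ : ∃ m, n = k + m := ⟨n - k, by omega⟩
    rw [show k + m + 1 - 1 - k = m by omega, show k + m - k = m by omega,
      show 2 * (k + m) + 1 - m = 2 * k + m + 1 by omega,
      show 2 * (k + m) + 1 - (k + m + 1 + k) = m by omega]
    generalize gb (2 * (k + m) + 1) m = G
    have e0 : ∀ m : ℕ, m.choose 2 + m = (m+1).choose 2 := by
      intro m; rw [Nat.choose_succ_succ' m 1, Nat.choose_one_right, add_comm]
    have e1 : m.choose 2 + (k + m) * (2 * k + m + 1) =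
        ((k + m).choose 2 + (k + m) + (k + m) * (k + m)) + (k + 1).choose 2 := by
      have t1 := e0 m
      have t2 := e0 (k + m)
      have t3 := two_choose m
      have t4 := two_choose k
      have t5 := two_choose (k + m)
      nlinarith
    have e2 : (k + m + 1 + k).choose 2 + (k + m) * m =
        ((k + m).choose 2 + (k + m) + (k + m) * (k + m)) + (k + 1).choose 2 := by
      have t2 := e0 (k + m)
      have t3 := two_choose (k + m + k)
      rw [show k + m + k + 1 = k + m + 1 + k by ring] at t3
      have t4 := two_choose k
      have t5 := two_choose (k + m)
      nlinarith
    have f1 : (X : K⟦X⟧) ^ (m.choose 2) * (X ^ (k + m)) ^ (2 * k + m + 1) =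
        X ^ ((k + m).choose 2 + (k + m) + (k + m) * (k + m)) * X ^ ((k + 1).choose 2) := by
      rw [← pow_mul, ← pow_add, ← pow_add, e1]
    have f2 : (X : K⟦X⟧) ^ ((k + m + 1 + k).choose 2) * (X ^ (k + m)) ^ m =
        X ^ ((k + m).choose 2 + (k + m) + (k + m) * (k + m)) * X ^ ((k + 1).choose 2) := by
      rw [← pow_mul, ← pow_add, ← pow_add, e2]
    have s1 : (-1 : K⟦X⟧) ^ (k + m + 1 + k) = - (-1) ^ m := by
      rw [show k + m + 1 + k = 2 * k + (m + 1) by ring, pow_add, pow_mul]; simp [pow_succ]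
    have s2 : (-1 : K⟦X⟧) ^ (k + m + 1) * (-1) ^ k = - (-1) ^ m := by
      rw [← pow_add, s1]
    rw [s1]
    push_cast
    linear_combination (- (-1) ^ m * G * (k + m + 1 + k)) * f2 + ((-1) ^ m * G * m) * f1
      - (X ^ ((k + m).choose 2 + (k + m) + (k + m) * (k + m)) * X ^ ((k + 1).choose 2) * G * (2 * k + 1)) * s2

lemma jacobi (n : ℕ) : (X : K⟦X⟧) ^ (n + 1) ∣ E ^ 3 - ∑ k ∈ Finset.range (n + 1),
    (-1) ^ k * (2 * (k : K⟦X⟧) + 1) * X ^ ((k + 1).choose 2) := by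
  have h1 : (X : K⟦X⟧) ^ (n + 1) ∣ E ^ 3 - Q n ^ 3 := (E_dvd n).trans (sub_dvd_pow_sub_pow _ _ 3)
  have h2 : (X : K⟦X⟧) ^ (n + 1) ∣ Q n ^ 3 - ∑ k ∈ Finset.range (n + 1),
      (-1) ^ k * (2 * (k : K⟦X⟧) + 1) * X ^ ((k + 1).choose 2) := by
    rw [pow_succ (Q n), jacobi_fin, Finset.sum_mul, ← Finset.sum_sub_distrib]
    refine Finset.dvd_sum fun k hk => ?_
    have hk' : k ≤ n := by simpa [Nat.lt_succ_iff] using hk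
    have d : (X : K⟦X⟧) ^ (n - k + 1) ∣ gb (2 * n + 1) (n - k) * Q n - 1 := by
      rw [← ((isUnit_Q (n - k)).mul (isUnit_Q (n + 1 + k))).dvd_mul_left]
      have g := gb_Q (2 * n + 1) (n - k) (n + 1 + k) (by omega)
      rw [show Q (n - k) * Q (n + 1 + k) * (gb (2 * n + 1) (n - k) * Q n - 1) =
        Q n * (Q (2 * n + 1) - Q (n + 1 + k)) + Q (n + 1 + k) * (Q n - Q (n - k)) by
          rw [← g]; ring]
      refine dvd_add (Dvd.dvd.mul_left ?_ _) (Dvd.dvd.mul_left (Q_dvd _ _ (by omega)) _)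
      exact (pow_dvd_pow _ (by omega)).trans (Q_dvd (n + 1 + k) (2 * n + 1) (by omega))
    have hc : k ≤ (k + 1).choose 2 := by
      rw [Nat.choose_succ_succ' k 1, Nat.choose_one_right]; omega
    have d2 := mul_dvd_mul (dvd_refl ((X : K⟦X⟧) ^ ((k + 1).choose 2))) d
    rw [← pow_add] at d2
    have d3 := (pow_dvd_pow (X : K⟦X⟧) (show n + 1 ≤ (k + 1).choose 2 + (n - k + 1) by omega)).trans d2
    have d4 := Dvd.dvd.mul_left d3 ((-1) ^ k * (2 * k + 1))
    convert d4 using 1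
    ring
  have := dvd_add h1 h2
  simpa using this

lemma coeff_E3 (m : ℕ) (h : m % 11 = 2 ∨ m % 11 = 4 ∨ m % 11 = 5 ∨ m % 11 = 7 ∨ m % 11 = 8 ∨ m % 11 = 9) :
    coeff m (E ^ 3) = 0 := by
  have h1 := X_pow_dvd_iff.1 (jacobi m) m (by omega)
  rw [map_sub, sub_eq_zero] at h1
  rw [h1, map_sum]
  refine Finset.sum_eq_zero fun k _ => ?_
  have e : ((-1) ^ k * (2 * k + 1) : K⟦X⟧) = C ((-1) ^ k * (2 * k + 1) : K) := by
    rw [map_mul, map_add, map_mul, map_pow, map_neg, map_one, map_natCast, map_ofNat]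
  rw [e, coeff_C_mul, coeff_X_pow]
  split_ifs with hm
  · have t := two_choose k
    rw [← hm] at t
    have h2 : (m * 2) % 11 = ((k % 11) * (k % 11 + 1)) % 11 := by
      rw [t]; simp [Nat.mul_mod, Nat.add_mod]
    have h5 : k % 11 = 5 := by
      have h4 : k % 11 < 11 := by omega
      generalize k % 11 = l at *
      interval_cases l <;> omega
    have h6 : ((2 * k + 1 : ℕ) : K) = 0 := by
      rw [ZMod.natCast_eq_zero_iff]; omega
    push_cast at h6
    rw [h6]; simp
  · simp

lemma pr_E11 (r : ℕ) (f : K⟦X⟧) (h0 : r ≠ 0) : pr r (f ^ 11) = 0 :=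
  pr_eq_zero _ _ fun n hn => coeff_pow11 f n (by omega)

lemma pr_mul_E11 (r : ℕ) (hr : r < 11) (f g : K⟦X⟧) :
    pr r (f * g ^ 11) = pr r f * pr 0 (g ^ 11) := by
  rw [pr_mul r hr, Finset.sum_eq_single r]
  · rw [show (r + 11 - r) % 11 = 0 by omega]
  · intro s hs hsr
    rw [Finset.mem_range] at hs
    rw [pr_E11 _ _ (by omega), mul_zero]
  · intro h
    exact absurd (Finset.mem_range.2 hr) h

lemma pr0_E11 (g : K⟦X⟧) : pr 0 (g ^ 11) = g ^ 11 := by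
  ext n
  rw [coeff_pr]
  split_ifs with h
  · rfl
  · rw [coeff_pow11 g n (by omega)]

lemma pr_E12 (r : ℕ) (h : r = 3 ∨ r = 6 ∨ r = 8 ∨ r = 9 ∨ r = 10) : pr r ((E ^ 3) ^ 4) = 0 := by
  rw [show (E ^ 3) ^ 4 = E * E ^ 11 by ring, pr_mul_E11 r (by omega),
    pr_eq_zero r E fun n hn => coeff_E n (by omega), zero_mul]

lemma pr_E3 (r : ℕ) (h : r = 2 ∨ r = 4 ∨ r = 5 ∨ r = 7 ∨ r = 8 ∨ r = 9) : pr r (E ^ 3) = 0 :=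
  pr_eq_zero r _ fun n hn => coeff_E3 n (by omega)

lemma pr_E21 : pr 6 ((E ^ 3) ^ 7) = 0 :=
  key _ (pr_E3 _ (by norm_num)) (pr_E3 _ (by norm_num)) (pr_E3 _ (by norm_num))
    (pr_E3 _ (by norm_num)) (pr_E3 _ (by norm_num)) (pr_E3 _ (by norm_num))
    (pr_E12 _ (by norm_num)) (pr_E12 _ (by norm_num)) (pr_E12 _ (by norm_num))
    (pr_E12 _ (by norm_num)) (pr_E12 _ (by norm_num))

end PC11

/-- Ramanujan's congruence `p(11n+6) ≡ 0 (mod 11)` for the partition function. -/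
theorem partition_congruence_mod_eleven (n : ℕ) :
    Fintype.card (Nat.Partition (11 * n + 6)) % 11 = 0 := by
  open PC11 PowerSeries in
  obtain ⟨P, hP⟩ : ∃ P : K⟦X⟧, P = PowerSeries.mk fun n => (Fintype.card (Nat.Partition n) : K) :=
    ⟨_, rfl⟩
  have hPE : P * E = 1 := by rw [hP]; exact P_mul_E
  have hE : E ≠ 0 := right_ne_zero_of_mul (hPE.symm ▸ one_ne_zero)
  have h21 : (E ^ 3) ^ 7 = P * (E ^ 2) ^ 11 := by
    linear_combination (-(E ^ 21)) * hPE
  have h := pr_E21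
  rw [h21, pr_mul_E11 6 (by norm_num), pr0_E11] at h
  have h6 : pr 6 P = 0 := (mul_eq_zero.1 h).resolve_right (pow_ne_zero _ (pow_ne_zero _ hE))
  have hc := pr_sum 6 P (11 * n + 6) h6 (by omega)
  rw [hP, coeff_mk, ZMod.natCast_eq_zero_iff] at hc
  exact Nat.mod_eq_zero_of_dvd hc
end
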